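/- Convergence of approximate action regions: assume (H.1) and (H.2), let u and u^ρ (ρ > 0) be the bounded viscosity solutions of the HJBQVI system and of the penalized systems, and assume there is a function ω: (0,∞) → (0,∞) with ω(ρ) → 0 as ρ → ∞ and 0 ≤ u^ρ_i − u_i ≤ ω(ρ) on ℝ^d for all i and ρ. Define the action regions S_i = {x ∈ ℝ^d : u_i(x) = (M_i u)(x)} and the approximations S^ρ_i = {x ∈ ℝ^d : |u^ρ_i(x) − (M_i u^ρ)(x)| ≤ ω(ρ)}. Then S_i ⊆ S^ρ_i for all i ∈ ℐ and ρ > 0, and for every compact set K ⊂ ℝ^d, S^ρ_i ∩ K converges to S_i ∩ K in the Hausdorff metric as ρ → ∞. -/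

import Mathlib

noncomputable section
open scoped BigOperators RealInnerProductSpace
open Filter Topology Matrix

namespace HJBQVI

abbrev E (d : ℕ) : Type := EuclideanSpace ℝ (Fin d)

variable {d d' M : ℕ}

/-- Frobenius norm of a matrix. -/
def frobNorm (A : Matrix (Fin d) (Fin d') ℝ) : ℝ :=
  Real.sqrt (∑ k, ∑ l, (A k l) ^ 2)

/-- Hessian matrix of a real-valued function, via the second iterated Fréchet derivative. -/
def hess (φ : E d → ℝ) (x : E d) : Matrix (Fin d) (Fin d) ℝ :=
  Matrix.of fun i j =>
    iteratedFDeriv ℝ 2 φ x ![EuclideanSpace.single i (1 : ℝ), EuclideanSpace.single j (1 : ℝ)]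

/-- Semiconcavity with constant `C`. -/
def Semiconcave (φ : E d → ℝ) (C : ℝ) : Prop :=
  ∀ x h : E d, φ (x + h) - 2 * φ x + φ (x - h) ≤ C * ‖h‖ ^ 2

/-- Membership in `C⁰₁(ℝ^d)`: bounded, continuous, Lipschitz. -/
def InC01 (f : E d → ℝ) : Prop :=
  Continuous f ∧ (∃ C, ∀ x, |f x| ≤ C) ∧ ∃ L, ∀ x y, |f x - f y| ≤ L * ‖x - y‖

/-- Uniform boundedness of a system of functions. -/
def Bdd (u : Fin M → E d → ℝ) : Prop := ∃ C, ∀ i x, |u i x| ≤ C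

/-- Coefficient data for the weakly coupled HJB operator. -/
structure HJBData (d d' M : ℕ) (𝒜 : Type) [MetricSpace 𝒜] where
  A : Fin M → Set 𝒜
  σm : Fin M → 𝒜 → E d → Matrix (Fin d) (Fin d') ℝ
  bv : Fin M → 𝒜 → E d → E d
  cz : Fin M → 𝒜 → E d → ℝ
  runCost : Fin M → 𝒜 → E d → ℝ
  dcp : Fin M → Fin M → 𝒜 → E d → ℝ

variable {𝒜 𝒵 : Type} [MetricSpace 𝒜] [MetricSpace 𝒵]

/-- The linear operator `L^α_i(x, s, p, X)`. -/
def HJBData.L (P : HJBData d d' M 𝒜) (i : Fin M) (α : 𝒜) (x : E d)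
    (s : Fin M → ℝ) (p : E d) (X : Matrix (Fin d) (Fin d) ℝ) : ℝ :=
  - Matrix.trace (((1 : ℝ) / 2) • (P.σm i α x * (P.σm i α x)ᵀ) * X)
  - ⟪P.bv i α x, p⟫ + P.cz i α x * s i - P.runCost i α x
  - ∑ j ∈ Finset.univ.erase i, P.dcp i j α x * s j

/-- The Hamiltonian `sup_{α ∈ A_i} L^α_i`. -/
def HJBData.Ham (P : HJBData d d' M 𝒜) (i : Fin M) (x : E d)
    (s : Fin M → ℝ) (p : E d) (X : Matrix (Fin d) (Fin d) ℝ) : ℝ :=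
  sSup ((fun α => P.L i α x s p X) '' P.A i)

/-- Data of the impulse intervention operator. -/
structure ImpulseData (d M : ℕ) (𝒵 : Type) [MetricSpace 𝒵] where
  Z : Fin M → E d → Set 𝒵
  Γ : Fin M → E d → 𝒵 → E d
  K : Fin M → E d → 𝒵 → ℝ

/-- The intervention operator `(M_i u)(x) = min_{z ∈ Z_i(x)} [u_i(Γ_i(x,z)) + K_i(x,z)]`. -/
def ImpulseData.Mop (Q : ImpulseData d M 𝒵) (i : Fin M) (u : Fin M → E d → ℝ) (x : E d) : ℝ :=
  sInf ((fun z => u i (Q.Γ i x z) + Q.K i x z) '' Q.Z i x)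

/-- Type of (possibly nonlocal) degenerate elliptic operators. -/
abbrev Op (d M : ℕ) : Type :=
  Fin M → E d → (Fin M → E d → ℝ) → E d → Matrix (Fin d) (Fin d) ℝ → ℝ

/-- Viscosity subsolution (upper semicontinuous, tested from above by C² functions). -/
def IsSubsolution (F : Op d M) (u : Fin M → E d → ℝ) : Prop :=
  (∀ i, UpperSemicontinuous (u i)) ∧
  ∀ (i : Fin M) (φ : E d → ℝ), ContDiff ℝ 2 φ → ∀ x : E d,
    IsLocalMax (fun y => u i y - φ y) x → F i x u (gradient φ x) (hess φ x) ≤ 0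

/-- Viscosity supersolution. -/
def IsSupersolution (F : Op d M) (u : Fin M → E d → ℝ) : Prop :=
  (∀ i, LowerSemicontinuous (u i)) ∧
  ∀ (i : Fin M) (φ : E d → ℝ), ContDiff ℝ 2 φ → ∀ x : E d,
    IsLocalMin (fun y => u i y - φ y) x → 0 ≤ F i x u (gradient φ x) (hess φ x)

/-- Viscosity solution: continuous and both a sub- and a supersolution. -/
def IsSolution (F : Op d M) (u : Fin M → E d → ℝ) : Prop :=
  (∀ i, Continuous (u i)) ∧ IsSubsolution F u ∧ IsSupersolution F u

/-- Pure HJB operator. -/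
def Fhjb (P : HJBData d d' M 𝒜) : Op d M :=
  fun i x u p X => P.Ham i x (fun j => u j x) p X

/-- Obstacle problem operator with obstacle `Ψ`. -/
def Fob (P : HJBData d d' M 𝒜) (Ψ : Fin M → E d → ℝ) : Op d M :=
  fun i x u p X => max (P.Ham i x (fun j => u j x) p X) (u i x - Ψ i x)

/-- Penalized obstacle problem operator. -/
def FobPen (P : HJBData d d' M 𝒜) (Ψ : Fin M → E d → ℝ) (ρ : ℝ) : Op d M :=
  fun i x u p X => P.Ham i x (fun j => u j x) p X + ρ * max (u i x - Ψ i x) 0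

/-- The HJBQVI operator. -/
def Fqvi (P : HJBData d d' M 𝒜) (Q : ImpulseData d M 𝒵) : Op d M :=
  fun i x u p X => max (P.Ham i x (fun j => u j x) p X) (u i x - Q.Mop i u x)

/-- The penalized HJBQVI operator with penalty parameter `ρ`. -/
def Fpen (P : HJBData d d' M 𝒜) (Q : ImpulseData d M 𝒵) (ρ : ℝ) : Op d M :=
  fun i x u p X => P.Ham i x (fun j => u j x) p X + ρ * max (u i x - Q.Mop i u x) 0

/-- Assumption (H.1). -/
def H1 (P : HJBData d d' M 𝒜) (C lam0 : ℝ) : Prop :=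
  0 < lam0 ∧
  (∀ i, (P.A i).Nonempty ∧ IsCompact (P.A i)) ∧
  ∀ i, ∀ α ∈ P.A i,
    (∀ k l, Continuous fun x => P.σm i α x k l) ∧
    Continuous (P.bv i α) ∧ Continuous (P.cz i α) ∧ Continuous (P.runCost i α) ∧
    (∀ j, Continuous (P.dcp i j α)) ∧
    (∀ x, frobNorm (P.σm i α x) ≤ C) ∧
    (∀ x y, frobNorm (P.σm i α x - P.σm i α y) ≤ C * ‖x - y‖) ∧
    (∀ x, ‖P.bv i α x‖ ≤ C) ∧ (∀ x y, ‖P.bv i α x - P.bv i α y‖ ≤ C * ‖x - y‖) ∧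
    (∀ x, |P.cz i α x| ≤ C) ∧ (∀ x y, |P.cz i α x - P.cz i α y| ≤ C * ‖x - y‖) ∧
    (∀ x, |P.runCost i α x| ≤ C) ∧
    (∀ x y, |P.runCost i α x - P.runCost i α y| ≤ C * ‖x - y‖) ∧
    (∀ j, (∀ x, |P.dcp i j α x| ≤ C) ∧ ∀ x y, |P.dcp i j α x - P.dcp i j α y| ≤ C * ‖x - y‖) ∧
    (∀ j ∈ Finset.univ.erase i, ∀ x, 0 ≤ P.dcp i j α x) ∧
    ∀ x, lam0 ≤ P.cz i α x - ∑ j ∈ Finset.univ.erase i, P.dcp i j α x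

/-- Assumption (H.2). -/
def H2 (Q : ImpulseData d M 𝒵) (κ₀ : ℝ) : Prop :=
  0 < κ₀ ∧
  (∀ i x, (Q.Z i x).Nonempty ∧ IsCompact (Q.Z i x)) ∧
  (∀ i, Continuous fun p : E d × 𝒵 => Q.Γ i p.1 p.2) ∧
  (∀ i, Continuous fun p : E d × 𝒵 => Q.K i p.1 p.2) ∧
  (∀ (i : Fin M) (x : E d), ∀ ε > (0 : ℝ), ∃ δ > (0 : ℝ), ∀ y, dist y x < δ →
      Metric.hausdorffDist (Q.Z i x) (Q.Z i y) < ε) ∧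
  ∀ i x, ∀ z ∈ Q.Z i x, κ₀ ≤ Q.K i x z

/-- Assumption (H.3): `λ₀ > sup_{i,α} ([σ^α_i]₁² + [b^α_i]₁)`. -/
def H3 (P : HJBData d d' M 𝒜) (lam0 : ℝ) : Prop :=
  ∃ Kσ Kb : ℝ, 0 ≤ Kσ ∧ 0 ≤ Kb ∧ Kσ ^ 2 + Kb < lam0 ∧
    ∀ i, ∀ α ∈ P.A i,
      (∀ x y, frobNorm (P.σm i α x - P.σm i α y) ≤ Kσ * ‖x - y‖) ∧
      ∀ x y, ‖P.bv i α x - P.bv i α y‖ ≤ Kb * ‖x - y‖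

/-- Assumption (H.4): the intervention operator preserves Lipschitz functions,
`[M_i u]₁ ≤ sup_j [u_j]₁ + C`. -/
def H4 (Q : ImpulseData d M 𝒵) (C : ℝ) : Prop :=
  0 ≤ C ∧ ∀ u : Fin M → E d → ℝ, (∀ i, InC01 (u i)) →
    ∀ L : ℝ, 0 ≤ L → (∀ i x y, |u i x - u i y| ≤ L * ‖x - y‖) →
      ∀ i x y, |Q.Mop i u x - Q.Mop i u y| ≤ (L + C) * ‖x - y‖

/-- `C¹` regularity with bounded and Lipschitz derivative. -/
def C1Bound {F : Type} [NormedAddCommGroup F] [NormedSpace ℝ F] (f : E d → F) (C : ℝ) : Prop :=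
  ContDiff ℝ 1 f ∧ (∀ x, ‖fderiv ℝ f x‖ ≤ C) ∧
    ∀ x y, ‖fderiv ℝ f x - fderiv ℝ f y‖ ≤ C * ‖x - y‖

/-- Assumption (H.5). -/
def H5 (P : HJBData d d' M 𝒜) (C : ℝ) : Prop :=
  ∀ i, ∀ α ∈ P.A i,
    (∀ k l, C1Bound (fun x => P.σm i α x k l) C) ∧
    C1Bound (P.bv i α) C ∧ C1Bound (P.cz i α) C ∧
    (∀ j, C1Bound (P.dcp i j α) C) ∧
    Semiconcave (P.runCost i α) C

/-- Assumption (H.6): the intervention operator preserves semiconcave functions,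
`[M_i u]_{2,+} ≤ sup_j [u_j]_{2,+} + C`. -/
def H6 (Q : ImpulseData d M 𝒵) (C : ℝ) : Prop :=
  0 ≤ C ∧ ∀ u : Fin M → E d → ℝ, (∀ i, Continuous (u i)) → (∃ B, ∀ i x, |u i x| ≤ B) →
    ∀ Cu : ℝ, 0 ≤ Cu → (∀ i, Semiconcave (u i) Cu) →
      ∀ i, Semiconcave (fun x => Q.Mop i u x) (Cu + C)

/-- Switching intervention operator `(M_i u)(x) = min_{j ≠ i} [u_j(x) + k_{ij}(x)]`. -/
def Msw (k : Fin M → Fin M → E d → ℝ) (i : Fin M) (u : Fin M → E d → ℝ) (x : E d) : ℝ :=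
  sInf ((fun j => u j x + k i j x) '' {j | j ≠ i})

/-- The switching HJBQVI operator. -/
def Fsw (P : HJBData d d' M 𝒜) (k : Fin M → Fin M → E d → ℝ) : Op d M :=
  fun i x u p X => max (P.Ham i x (fun j => u j x) p X) (u i x - Msw k i u x)

/-- The componentwise penalized switching system operator. -/
def FswPen (P : HJBData d d' M 𝒜) (k : Fin M → Fin M → E d → ℝ) (ρ : ℝ) : Op d M :=
  fun i x u p X => P.Ham i x (fun j => u j x) p X
    + ρ * ∑ j ∈ Finset.univ.erase i, max (u i x - u j x - k i j x) 0

/-- Assumption (H.7) on signed switching costs. -/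
def H7 (k : Fin M → Fin M → E d → ℝ) (κ₀ C : ℝ) : Prop :=
  0 < κ₀ ∧ 0 ≤ C ∧
  (∀ i x, k i i x = 0) ∧
  (∀ i j l, j ≠ i → ∀ x : E d, κ₀ ≤ k i j x + k j l x - k i l x) ∧
  (∀ i j, (∀ x, |k i j x| ≤ C) ∧ ∀ x y, |k i j x - k i j y| ≤ C * ‖x - y‖) ∧
  ∀ i j (x : E d), k i j x < κ₀ → ∃ h₀ > (0 : ℝ), ∀ h : E d, ‖h‖ < h₀ →
    k i j (x + h) - 2 * k i j x + k i j (x - h) ≤ C * ‖h‖ ^ 2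

/-- `k̃_i = min{min_{j≠i}(k_{ji} − ε), 0}`. -/
def ktil (k : Fin M → Fin M → E d → ℝ) (ε : ℝ) (i : Fin M) (x : E d) : ℝ :=
  sInf (insert 0 ((fun j => k j i x - ε) '' {j | j ≠ i}))

/-- Strict viscosity subsolution with margin `g`: `F_i(x, u, Dφ, D²φ) ≤ g` at
every local maximum of `u_i − φ`. -/
def IsStrictSubsolution (F : Op d M) (g : ℝ) (u : Fin M → E d → ℝ) : Prop :=
  (∀ i, UpperSemicontinuous (u i)) ∧
  ∀ (i : Fin M) (φ : E d → ℝ), ContDiff ℝ 2 φ → ∀ x : E d,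
    IsLocalMax (fun y => u i y - φ y) x → F i x u (gradient φ x) (hess φ x) ≤ g

/-- Half-relaxed upper limit `u*(x) = limsup_{ρ→∞, y→x} u^ρ(y)`. -/
def relaxSup (u : ℕ → E d → ℝ) (x : E d) : ℝ :=
  Filter.limsup (fun p : ℕ × E d => u p.1 p.2) (Filter.atTop ×ˢ nhds x)

/-- Half-relaxed lower limit `u_*(x) = liminf_{ρ→∞, y→x} u^ρ(y)`. -/
def relaxInf (u : ℕ → E d → ℝ) (x : E d) : ℝ :=
  Filter.liminf (fun p : ℕ × E d => u p.1 p.2) (Filter.atTop ×ˢ nhds x)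

/-- Set of optimal impulse controls `𝒵^v_i(x)`. -/
def argminSet (Q : ImpulseData d M 𝒵) (v : Fin M → E d → ℝ) (i : Fin M) (x : E d) : Set 𝒵 :=
  {z | z ∈ Q.Z i x ∧ ∀ z' ∈ Q.Z i x,
    v i (Q.Γ i x z) + Q.K i x z ≤ v i (Q.Γ i x z') + Q.K i x z'}


theorem sInf_image_le_sInf_image_add {β γ : Type*} {s : Set β} {t : Set γ} {f : β → ℝ}
    {g : γ → ℝ} {δ : ℝ} (hf : BddBelow (f '' s)) (ht : t.Nonempty)
    (h : ∀ b ∈ t, ∃ a ∈ s, f a ≤ g b + δ) : sInf (f '' s) ≤ sInf (g '' t) + δ := by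
  rw [← sub_le_iff_le_add]
  refine le_csInf (ht.image g) ?_
  rintro _ ⟨b, hb, rfl⟩
  obtain ⟨a, ha, hab⟩ := h b hb
  rw [sub_le_iff_le_add]
  exact (csInf_le hf (Set.mem_image_of_mem f ha)).trans hab

theorem bddBelow_intervention_image {Q : ImpulseData d M 𝒵} {κ₀ : ℝ} (h2 : H2 Q κ₀)
    {v : Fin M → E d → ℝ} (hv : Bdd v) (i : Fin M) (x : E d) :
    BddBelow ((fun z => v i (Q.Γ i x z) + Q.K i x z) '' Q.Z i x) := by
  obtain ⟨B, hB⟩ := hv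
  obtain ⟨-, -, -, -, -, hK⟩ := h2
  refine ⟨-B + κ₀, ?_⟩
  rintro _ ⟨z, hz, rfl⟩
  exact add_le_add (neg_le_of_abs_le (hB i _)) (hK i x z hz)

/-- A one-sided bound between two functions passes to their images under the intervention
operator. -/
theorem Mop_le_Mop_add {Q : ImpulseData d M 𝒵} {κ₀ : ℝ} (h2 : H2 Q κ₀)
    {v w : Fin M → E d → ℝ} (hv : Bdd v) {δ : ℝ} {i : Fin M} (h : ∀ x, v i x ≤ w i x + δ)
    (x : E d) : Q.Mop i v x ≤ Q.Mop i w x + δ := by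
  refine sInf_image_le_sInf_image_add (bddBelow_intervention_image h2 hv i x) (h2.2.1 i x).1 ?_
  intro z hz
  exact ⟨z, hz, by linarith [h (Q.Γ i x z)]⟩

/-- The intervention operator maps bounded continuous functions to continuous functions. -/
theorem continuous_Mop {Q : ImpulseData d M 𝒵} {κ₀ : ℝ} (h2 : H2 Q κ₀)
    {v : Fin M → E d → ℝ} (hv : Bdd v) {i : Fin M} (hc : Continuous (v i)) :
    Continuous (Q.Mop i v) := by
  have hbdd := bddBelow_intervention_image h2 hv i
  obtain ⟨-, hZ, hΓ, hK, hZc, -⟩ := h2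
  have hf : Continuous fun p : E d × 𝒵 => v i (Q.Γ i p.1 p.2) + Q.K i p.1 p.2 :=
    (hc.comp (hΓ i)).add (hK i)
  rw [Metric.continuous_iff]
  intro x ε hε
  have huc := ((isCompact_singleton (x := x)).prod (hZ i x).2).uniformContinuousAt_of_continuousAt
    _ (fun p _ => hf.continuousAt) (Metric.dist_mem_uniformity (half_pos hε))
  obtain ⟨δ, hδ, hclose⟩ := Metric.mem_uniformity_dist.1 huc
  have hclose' : ∀ y, dist y x < δ → ∀ z ∈ Q.Z i x, ∀ z', dist z z' < δ →
      |(v i (Q.Γ i x z) + Q.K i x z) - (v i (Q.Γ i y z') + Q.K i y z')| < ε / 2 := by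
    intro y hy z hz z' hz'
    have hd : dist (x, z) (y, z') < δ := by
      rw [Prod.dist_eq]
      exact max_lt (by rwa [dist_comm]) hz'
    exact hclose hd ⟨rfl, hz⟩
  obtain ⟨η, hη, hηZ⟩ := hZc i x δ hδ
  refine ⟨min δ η, lt_min hδ hη, fun y hy => ?_⟩
  have hyδ := hy.trans_le (min_le_left _ _)
  have hH := hηZ y (hy.trans_le (min_le_right _ _))
  have hfin := Metric.hausdorffEDist_ne_top_of_nonempty_of_bounded (hZ i x).1 (hZ i y).1
    (hZ i x).2.isBounded (hZ i y).2.isBounded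
  have hle : Q.Mop i v y ≤ Q.Mop i v x + ε / 2 := by
    refine sInf_image_le_sInf_image_add (hbdd y) (hZ i x).1 fun z hz => ?_
    obtain ⟨z', hz', hd⟩ := Metric.exists_dist_lt_of_hausdorffDist_lt hz hH hfin
    exact ⟨z', hz', by linarith [(abs_lt.1 (hclose' y hyδ z hz z' hd)).1]⟩
  have hge : Q.Mop i v x ≤ Q.Mop i v y + ε / 2 := by
    refine sInf_image_le_sInf_image_add (hbdd x) (hZ i y).1 fun z' hz' => ?_
    obtain ⟨z, hz, hd⟩ := Metric.exists_dist_lt_of_hausdorffDist_lt' hz' hH hfin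
    exact ⟨z, hz, by linarith [(abs_lt.1 (hclose' y hyδ z hz z' hd)).2]⟩
  rw [Real.dist_eq, abs_lt]
  constructor <;> linarith

/-- On a compact set, the sublevel sets of a continuous function approach its zero set. -/
theorem exists_pos_forall_le_exists_zero_dist_lt {X : Type*} [PseudoMetricSpace X] {g : X → ℝ}
    (hg : Continuous g) {s : Set X} (hs : IsCompact s) {ε : ℝ} (hε : 0 < ε) :
    ∃ m > 0, ∀ x ∈ s, |g x| < m → ∃ y ∈ s, g y = 0 ∧ dist x y < ε := by
  set U := Metric.thickening ε {y | y ∈ s ∧ g y = 0}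
  have hpos : ∀ x ∈ s \ U, 0 < |g x| := fun x hx =>
    abs_pos.2 fun h0 => hx.2 (Metric.self_subset_thickening hε _ ⟨hx.1, h0⟩)
  obtain ⟨m, hm, hmle⟩ := (hs.diff Metric.isOpen_thickening).exists_forall_le'
    hg.abs.continuousOn hpos
  refine ⟨m, hm, fun x hx hlt => ?_⟩
  have hxU : x ∈ U := by
    by_contra hxU
    exact (hmle x ⟨hx, hxU⟩).not_gt hlt
  obtain ⟨y, hy, hd⟩ := Metric.mem_thickening_iff.1 hxU
  exact ⟨y, hy.1, hy.2, hd⟩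

/-- Convergence of approximate action regions: `S_i ⊆ S^ρ_i`, and on
every compact set `S^ρ_i ∩ K → S_i ∩ K` in the Hausdorff metric as `ρ → ∞`. -/
theorem action_region_convergence
    {d d' M : ℕ} {𝒜 𝒵 : Type} [MetricSpace 𝒜] [MetricSpace 𝒵]
    (P : HJBData d d' M 𝒜) (Q : ImpulseData d M 𝒵) (C lam0 κ₀ : ℝ)
    (h1 : H1 P C lam0) (h2 : H2 Q κ₀)
    (u : Fin M → E d → ℝ) (hu : Bdd u ∧ IsSolution (Fqvi P Q) u)
    (uρ : ℝ → Fin M → E d → ℝ)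
    (huρ : ∀ ρ : ℝ, 0 < ρ → Bdd (uρ ρ) ∧ IsSolution (Fpen P Q ρ) (uρ ρ))
    (ω : ℝ → ℝ) (hωpos : ∀ ρ : ℝ, 0 < ρ → 0 < ω ρ)
    (hωlim : Filter.Tendsto ω Filter.atTop (nhds 0))
    (hest : ∀ ρ : ℝ, 0 < ρ → ∀ (i : Fin M) (x : E d),
      0 ≤ uρ ρ i x - u i x ∧ uρ ρ i x - u i x ≤ ω ρ) :
    (∀ i : Fin M, ∀ ρ : ℝ, 0 < ρ →
      {x : E d | u i x = Q.Mop i u x} ⊆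
        {x : E d | |uρ ρ i x - Q.Mop i (uρ ρ) x| ≤ ω ρ}) ∧
    ∀ Kset : Set (E d), IsCompact Kset → ∀ i : Fin M,
      Filter.Tendsto (fun ρ : ℝ => Metric.hausdorffDist
          ({x : E d | |uρ ρ i x - Q.Mop i (uρ ρ) x| ≤ ω ρ} ∩ Kset)
          ({x : E d | u i x = Q.Mop i u x} ∩ Kset))
        Filter.atTop (nhds 0) := by
  have hM : ∀ ρ : ℝ, 0 < ρ → ∀ (i : Fin M) (x : E d),
      Q.Mop i u x ≤ Q.Mop i (uρ ρ) x ∧ Q.Mop i (uρ ρ) x ≤ Q.Mop i u x + ω ρ := by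
    intro ρ hρ i x
    constructor
    · simpa using Mop_le_Mop_add h2 hu.1 (w := uρ ρ) (δ := 0) (i := i)
        (fun y => by linarith [(hest ρ hρ i y).1]) x
    · exact Mop_le_Mop_add h2 (huρ ρ hρ).1 (fun y => by linarith [(hest ρ hρ i y).2]) x
  have hsub : ∀ i : Fin M, ∀ ρ : ℝ, 0 < ρ →
      {x : E d | u i x = Q.Mop i u x} ⊆
        {x : E d | |uρ ρ i x - Q.Mop i (uρ ρ) x| ≤ ω ρ} := by
    intro i ρ hρ x hx
    have hx' : u i x = Q.Mop i u x := hx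
    obtain ⟨h3, h4⟩ := hM ρ hρ i x
    obtain ⟨h5, h6⟩ := hest ρ hρ i x
    rw [Set.mem_ofPred_eq, abs_le]
    constructor <;> linarith
  refine ⟨hsub, fun Kset hK i => ?_⟩
  rw [Metric.tendsto_nhds]
  intro ε hε
  have hcu : Continuous (u i) := hu.2.1 i
  obtain ⟨m, hm, hmK⟩ := exists_pos_forall_le_exists_zero_dist_lt
    (hcu.sub (continuous_Mop h2 hu.1 hcu)) hK (half_pos hε)
  filter_upwards [hωlim.eventually (gt_mem_nhds (half_pos hm)), eventually_gt_atTop 0]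
    with ρ hωm hρ
  rw [Real.dist_eq, sub_zero, abs_of_nonneg Metric.hausdorffDist_nonneg]
  refine (Metric.hausdorffDist_le_of_mem_dist (half_pos hε).le ?_ ?_).trans_lt (half_lt_self hε)
  · rintro x ⟨hx, hxK⟩
    obtain ⟨h3, h4⟩ := hM ρ hρ i x
    obtain ⟨h5, h6⟩ := hest ρ hρ i x
    obtain ⟨h7, h8⟩ := abs_le.1 (show |uρ ρ i x - Q.Mop i (uρ ρ) x| ≤ ω ρ from hx)
    obtain ⟨y, hyK, hy, hd⟩ := hmK x hxK
      (abs_lt.2 ⟨by simp only [Pi.sub_apply]; linarith, by simp only [Pi.sub_apply]; linarith⟩)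
    exact ⟨y, ⟨sub_eq_zero.1 hy, hyK⟩, hd.le⟩
  · rintro x ⟨hx, hxK⟩
    exact ⟨x, ⟨hsub i ρ hρ hx, hxK⟩, by simpa using (half_pos hε).le⟩
end HJBQVI
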